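/- Fix −1 < ρ < 1. For each z ∈ ℂ there exists a unique probability measure ν_z on the real line such that its Stieltjes transform a(η,z) := ∫_ℝ 1/(u − η) dν_z(u) satisfies, for all η in the upper half plane ℂ⁺ = {w ∈ ℂ : Im(w) > 0}, the self-consistent equation 1/(a(η,z)·(η + a(η,z))) + 1 = Re(z)²/(η + (1+ρ)a(η,z))² + Im(z)²/(η + (1−ρ)a(η,z))². -/

import Mathlib

open MeasureTheory

noncomputable section

/-- The Stieltjes transform of a measure `ν` on `ℝ`, evaluated at `η ∈ ℂ⁺`. -/
def stieltjes (ν : Measure ℝ) (η : ℂ) : ℂ :=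
  ∫ u : ℝ, ((u : ℂ) - η)⁻¹ ∂ν

/-- The self-consistent equation satisfied by the Stieltjes transform `a(·,z)` of `ν_z`. -/
def SelfConsistent (ρ : ℝ) (z : ℂ) (ν : Measure ℝ) : Prop :=
  ∀ η : ℂ, 0 < η.im →
    1 / (stieltjes ν η * (η + stieltjes ν η)) + 1 =
      (z.re : ℂ) ^ 2 / (η + (1 + ρ) * stieltjes ν η) ^ 2 +
        (z.im : ℂ) ^ 2 / (η + (1 - ρ) * stieltjes ν η) ^ 2


lemma sub_ne_zero_of_im {η : ℂ} (h : 0 < η.im) (u : ℝ) : (u : ℂ) - η ≠ 0 := by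
  intro h0
  have := congrArg Complex.im h0
  simp at this
  linarith

lemma norm_inv_le {η : ℂ} (h : 0 < η.im) (u : ℝ) : ‖((u : ℂ) - η)⁻¹‖ ≤ η.im⁻¹ := by
  rw [norm_inv]
  apply inv_anti₀ h
  have := Complex.abs_im_le_norm ((u : ℂ) - η)
  simp at this
  exact (le_abs_self _).trans this

lemma cont_res {η : ℂ} (h : 0 < η.im) : Continuous (fun u : ℝ => ((u : ℂ) - η)⁻¹) := by
  apply Continuous.inv₀ (by fun_prop)
  exact sub_ne_zero_of_im h

lemma integrable_res (ν : Measure ℝ) [IsProbabilityMeasure ν] {η : ℂ} (h : 0 < η.im) :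
    Integrable (fun u : ℝ => ((u : ℂ) - η)⁻¹) ν := by
  apply Integrable.of_bound (cont_res h).aestronglyMeasurable (C := η.im⁻¹)
  exact ae_of_all _ (norm_inv_le h)

lemma stieltjes_norm_le (ν : Measure ℝ) [IsProbabilityMeasure ν] {η : ℂ} (h : 0 < η.im) :
    ‖stieltjes ν η‖ ≤ η.im⁻¹ := by
  have := norm_integral_le_of_norm_le_const (μ := ν) (ae_of_all _ (norm_inv_le h))
  simpa [stieltjes] using this

lemma res_im {η : ℂ} (u : ℝ) :
    (((u : ℂ) - η)⁻¹).im = η.im / ((u - η.re) ^ 2 + η.im ^ 2) := by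
  rw [Complex.inv_im, Complex.normSq_apply]
  simp
  ring_nf

lemma stieltjes_im (ν : Measure ℝ) [IsProbabilityMeasure ν] {η : ℂ} (h : 0 < η.im) :
    (stieltjes ν η).im = ∫ u : ℝ, η.im / ((u - η.re) ^ 2 + η.im ^ 2) ∂ν := by
  have := integral_im (integrable_res ν h)
  simp only [RCLike.im_to_complex] at this
  rw [stieltjes, ← this]
  simp_rw [res_im]

lemma integrable_res_im (ν : Measure ℝ) [IsProbabilityMeasure ν] {η : ℂ} (h : 0 < η.im) :
    Integrable (fun u : ℝ => η.im / ((u - η.re) ^ 2 + η.im ^ 2)) ν := by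
  have := (integrable_res ν h).im
  simpa only [RCLike.im_to_complex, res_im] using this

lemma stieltjes_im_pos (ν : Measure ℝ) [IsProbabilityMeasure ν] {η : ℂ} (h : 0 < η.im) :
    0 < (stieltjes ν η).im := by
  rw [stieltjes_im ν h]
  rw [integral_pos_iff_support_of_nonneg (fun u => by positivity) (integrable_res_im ν h)]
  have : Function.support (fun u : ℝ => η.im / ((u - η.re) ^ 2 + η.im ^ 2)) = Set.univ := by
    ext u
    simp only [Function.mem_support, Set.mem_univ, iff_true]
    positivity
  rw [this]; simp

lemma isOpen_uhp : IsOpen {η : ℂ | 0 < η.im} := isOpen_lt continuous_const Complex.continuous_im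

lemma preconn_uhp : IsPreconnected {η : ℂ | 0 < η.im} :=
  (convex_halfSpace_im_gt 0).isPreconnected

lemma stieltjes_eq_resolventTransform (ν : Measure ℝ) : stieltjes ν = resolventTransform ν := by
  ext η
  simp [stieltjes, resolventTransform, resolvent]

lemma stieltjes_diff (ν : Measure ℝ) [IsProbabilityMeasure ν] :
    DifferentiableOn ℂ (stieltjes ν) {η : ℂ | 0 < η.im} := by
  intro η h
  rw [stieltjes_eq_resolventTransform]
  apply (hasDerivAt_resolventTransform η ?_).differentiableAt.differentiableWithinAt
  rintro ⟨x, -, hx⟩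
  apply sub_ne_zero_of_im h x
  rw [sub_eq_zero]; simpa using hx

lemma uhp_eqOn {f g : ℂ → ℂ} (hf : DifferentiableOn ℂ f {η : ℂ | 0 < η.im})
    (hg : DifferentiableOn ℂ g {η : ℂ | 0 < η.im}) (T : ℝ)
    (h : ∀ η : ℂ, T < η.im → 0 < η.im → f η = g η) : Set.EqOn f g {η : ℂ | 0 < η.im} := by
  have h0 : ((|T| + 1 : ℝ) * Complex.I : ℂ) ∈ {η : ℂ | 0 < η.im} := by
    simp; positivity
  refine (hf.analyticOnNhd isOpen_uhp).eqOn_of_preconnected_of_eventuallyEq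
    (hg.analyticOnNhd isOpen_uhp) preconn_uhp h0 ?_
  have hT : {η : ℂ | T < η.im} ∈ nhds ((|T| + 1 : ℝ) * Complex.I : ℂ) := by
    apply (isOpen_lt continuous_const Complex.continuous_im).mem_nhds
    simp; linarith [le_abs_self T]
  filter_upwards [hT, isOpen_uhp.mem_nhds h0] with η h1 h2 using h η h1 h2

lemma lintegral_subst (g : ℝ → ENNReal) (hg : Measurable g) (u ε : ℝ) (hε : 0 < ε) :
    ∫⁻ x, g x = ENNReal.ofReal ε * ∫⁻ s, g (u + ε * s) := by
  rw [← lintegral_add_left_eq_self g u]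
  conv_lhs => rw [← Real.smul_map_volume_mul_left hε.ne']
  rw [lintegral_smul_measure, lintegral_map (by fun_prop) (by fun_prop), abs_of_pos hε]
  rfl

def kk (s : ℝ) : ENNReal := ENNReal.ofReal ((1 + s ^ 2)⁻¹)

lemma kk_meas : Measurable kk := by
  unfold kk; fun_prop

lemma kk_int : ∫⁻ s, kk s = ENNReal.ofReal Real.pi := by
  unfold kk
  rw [← ofReal_integral_eq_lintegral_ofReal integrable_inv_one_add_sq
    (ae_of_all _ fun s => by positivity), integral_univ_inv_one_add_sq]

lemma kk_stieltjes (ν : Measure ℝ) [IsProbabilityMeasure ν] (x ε : ℝ) (hε : 0 < ε) :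
    ∫⁻ u, kk ((x - u) / ε) ∂ν = ENNReal.ofReal (ε * (stieltjes ν (x + ε * Complex.I)).im) := by
  have him : 0 < ((x : ℂ) + ε * Complex.I).im := by simpa using hε
  rw [stieltjes_im ν him, ← integral_const_mul, ofReal_integral_eq_lintegral_ofReal
    ((integrable_res_im ν him).const_mul ε)
    (ae_of_all _ fun s => by simp; positivity)]
  congr 1
  ext u
  unfold kk
  congr 1
  simp
  field_simp
  ring

lemma J_eq (ν : Measure ℝ) [IsProbabilityMeasure ν] (f : BoundedContinuousFunction ℝ NNReal)
    (ε : ℝ) (hε : 0 < ε) :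
    ENNReal.ofReal ε * ∫⁻ q : ℝ × ℝ, (f (q.1 + ε * q.2) : ENNReal) * kk q.2 ∂(ν.prod volume)
     = ∫⁻ x, f x * ENNReal.ofReal (ε * (stieltjes ν (x + ε * Complex.I)).im) := by
  have hk := kk_meas
  have hf : Measurable f := f.continuous.measurable
  rw [lintegral_prod _ (by fun_prop), ← lintegral_const_mul _ (by fun_prop)]
  have : ∀ u : ℝ, ENNReal.ofReal ε * ∫⁻ s, (f (u + ε * s) : ENNReal) * kk s
      = ∫⁻ x, (f x : ENNReal) * kk ((x - u) / ε) := by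
    intro u
    rw [lintegral_subst (fun x => (f x : ENNReal) * kk ((x - u) / ε)) (by fun_prop) u ε hε]
    congr 1
    congr 1
    ext s
    congr 2
    field_simp
    ring
  simp_rw [this]
  rw [lintegral_lintegral_swap (by fun_prop)]
  congr 1
  ext x
  rw [lintegral_const_mul _ (by fun_prop), kk_stieltjes ν x ε hε]

lemma J_lim (ν : Measure ℝ) [IsProbabilityMeasure ν] (f : BoundedContinuousFunction ℝ NNReal) :
    Filter.Tendsto (fun n : ℕ => ∫⁻ q : ℝ × ℝ,
      (f (q.1 + (1 / ((n : ℝ) + 1)) * q.2) : ENNReal) * kk q.2 ∂(ν.prod volume)) Filter.atTop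
      (nhds ((∫⁻ u, f u ∂ν) * ENNReal.ofReal Real.pi)) := by
  have hk := kk_meas
  have hf : Measurable f := f.continuous.measurable
  have e : (∫⁻ u, f u ∂ν) * ENNReal.ofReal Real.pi =
      ∫⁻ q : ℝ × ℝ, (f q.1 : ENNReal) * kk q.2 ∂(ν.prod volume) := by
    rw [lintegral_prod_mul (f := fun u => (f u : ENNReal)) (by fun_prop) (by fun_prop), kk_int]
  rw [e]
  refine tendsto_lintegral_filter_of_dominated_convergence
    (fun q => ((nndist f 0 : NNReal) : ENNReal) * kk q.2) ?_ ?_ ?_ ?_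
  · exact Filter.Eventually.of_forall fun n => by fun_prop
  · refine Filter.Eventually.of_forall fun n => ae_of_all _ fun q => ?_
    gcongr
    exact BoundedContinuousFunction.NNReal.upper_bound f _
  · rw [lintegral_prod_mul (f := fun _ => ((nndist f 0 : NNReal) : ENNReal)) (by fun_prop) (by fun_prop), kk_int]
    simp [ENNReal.mul_eq_top]
  · refine ae_of_all _ fun q => ?_
    apply ENNReal.Tendsto.mul_const
    · apply ENNReal.tendsto_coe.2
      have : Filter.Tendsto (fun n : ℕ => q.1 + (1 / ((n : ℝ) + 1)) * q.2) Filter.atTop (nhds (q.1 + 0 * q.2)) :=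
        (tendsto_one_div_add_atTop_nhds_zero_nat.mul_const _).const_add _
      simp only [zero_mul, add_zero] at this
      exact (f.continuous.tendsto _).comp this
    · right; simp [kk]

lemma stieltjes_inj (μ ν : Measure ℝ) [IsProbabilityMeasure μ] [IsProbabilityMeasure ν]
    (h : ∀ η : ℂ, 0 < η.im → stieltjes μ η = stieltjes ν η) : μ = ν := by
  apply ext_of_forall_lintegral_eq_of_IsFiniteMeasure
  intro f
  have h1 := J_lim μ f
  have h2 := J_lim ν f
  have : (∫⁻ u, f u ∂μ) * ENNReal.ofReal Real.pi = (∫⁻ u, f u ∂ν) * ENNReal.ofReal Real.pi := by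
    refine tendsto_nhds_unique (h1.congr fun n => ?_) h2
    have hε : (0 : ℝ) < 1 / ((n : ℝ) + 1) := by positivity
    have e : ENNReal.ofReal (1 / ((n : ℝ) + 1)) ≠ 0 := by simpa using hε
    rw [← ENNReal.mul_right_inj e ENNReal.ofReal_ne_top, J_eq μ f _ hε, J_eq ν f _ hε]
    generalize 1 / ((n : ℝ) + 1) = ε at hε
    congr 1
    ext x
    rw [h]
    simpa using hε
  rwa [ENNReal.mul_left_inj (by simp [Real.pi_pos]) ENNReal.ofReal_ne_top] at this

lemma lip_aux (r : ℝ) (hr : |r| ≤ 1) (η a b : ℂ) (ha : ‖a‖ ≤ 1)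
    (hp : 1 ≤ ‖η + (1 + r) * a‖) (hq : 1 ≤ ‖η + (1 + r) * b‖) :
    ‖(η + b) / (η + (1 + r) * b) ^ 2 - (η + a) / (η + (1 + r) * a) ^ 2‖ ≤ 7 * ‖a - b‖ := by
  set p := η + (1 + r) * a with hpd
  set q := η + (1 + r) * b with hqd
  have p0 : p ≠ 0 := by rw [← norm_pos_iff]; linarith
  have q0 : q ≠ 0 := by rw [← norm_pos_iff]; linarith
  have e : (η + b) / q ^ 2 - (η + a) / p ^ 2 =
      (a - b) * ((1 + r) * (p⁻¹ * q⁻¹) + r * (q⁻¹ ^ 2)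
        + -r * a * (1 + r) * (p⁻¹ * q⁻¹ ^ 2 + p⁻¹ ^ 2 * q⁻¹)) := by
    have e1 : η + b = q - r * b := by rw [hqd]; ring
    have e2 : η + a = p - r * a := by rw [hpd]; ring
    have e3 : (1 + r) * (a - b) = p - q := by rw [hpd, hqd]; ring
    rw [e1, e2]
    trans ((1 + r) * (a - b)) * (p⁻¹ * q⁻¹) + r * (a - b) * (q⁻¹ ^ 2)
        + -r * a * ((1 + r) * (a - b)) * (p⁻¹ * q⁻¹ ^ 2 + p⁻¹ ^ 2 * q⁻¹)
    · rw [e3]; field_simp; ring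
    · ring
  have hp1 : ‖p⁻¹‖ ≤ 1 := by rw [norm_inv]; exact inv_le_one_of_one_le₀ hp
  have hq1 : ‖q⁻¹‖ ≤ 1 := by rw [norm_inv]; exact inv_le_one_of_one_le₀ hq
  have hr1 : ‖(r : ℂ)‖ ≤ 1 := by simpa using hr
  have hr2 : ‖(1 + r : ℂ)‖ ≤ 2 := by
    refine (norm_add_le _ _).trans ?_
    simp only [norm_one]; linarith
  rw [e, norm_mul, mul_comm]
  gcongr
  calc _ ≤ ‖(1 + r : ℂ) * (p⁻¹ * q⁻¹)‖ + ‖r * (q⁻¹ ^ 2)‖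
        + ‖-r * a * (1 + r) * (p⁻¹ * q⁻¹ ^ 2 + p⁻¹ ^ 2 * q⁻¹)‖ := norm_add₃_le
    _ ≤ 2 * (1 * 1) + 1 * 1 ^ 2 + 1 * 1 * 2 * (1 * 1 ^ 2 + 1 ^ 2 * 1) := by
      have h5 : ‖p⁻¹ * q⁻¹ ^ 2 + p⁻¹ ^ 2 * q⁻¹‖ ≤ (1 * 1 ^ 2 + 1 ^ 2 * 1) := by
        refine (norm_add_le _ _).trans ?_
        rw [norm_mul, norm_mul, norm_pow, norm_pow]
        gcongr
      rw [norm_mul, norm_mul, norm_mul, norm_pow, norm_mul, norm_mul, norm_mul, norm_neg]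
      gcongr
    _ = 7 := by norm_num

lemma im_facts {r : ℝ} (hr : r ∈ Set.Ioo (-1 : ℝ) 1) {η a : ℂ} (_ : 0 < η.im) (ha : 0 < a.im) :
    η.im ≤ ‖η + (1 + r) * a‖ := by
  have := Complex.abs_im_le_norm (η + (1 + r) * a)
  simp at this
  have h2 : 0 < (1 + r) * a.im := mul_pos (by linarith [hr.1]) ha
  linarith [le_abs_self (η.im + (1 + r) * a.im)]

lemma eq_of_sc (ρ : ℝ) (hρ : ρ ∈ Set.Ioo (-1 : ℝ) 1) (x y : ℝ) (η a b : ℂ)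
    (hη : 1 + 7 * (x ^ 2 + y ^ 2) < η.im) (ha0 : 0 < a.im) (hb0 : 0 < b.im)
    (ha : ‖a‖ ≤ η.im⁻¹) (hb : ‖b‖ ≤ η.im⁻¹)
    (h1 : 1 / (a * (η + a)) + 1 =
      (x : ℂ) ^ 2 / (η + (1 + ρ) * a) ^ 2 + (y : ℂ) ^ 2 / (η + (1 - ρ) * a) ^ 2)
    (h2 : 1 / (b * (η + b)) + 1 =
      (x : ℂ) ^ 2 / (η + (1 + ρ) * b) ^ 2 + (y : ℂ) ^ 2 / (η + (1 - ρ) * b) ^ 2) :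
    a = b := by
  have hT : 1 ≤ 1 + 7 * (x ^ 2 + y ^ 2) := by nlinarith [sq_nonneg x, sq_nonneg y]
  have hη1 : 1 < η.im := by linarith
  have hη0 : 0 < η.im := by linarith
  have hρ' : -ρ ∈ Set.Ioo (-1 : ℝ) 1 := ⟨by linarith [hρ.2], by linarith [hρ.1]⟩
  have hinv : η.im⁻¹ ≤ 1 := inv_le_one_of_one_le₀ hη1.le
  have L1 := lip_aux ρ (abs_le.2 ⟨hρ.1.le, hρ.2.le⟩) η a b (ha.trans hinv)
    (hη1.le.trans (im_facts hρ hη0 ha0)) (hη1.le.trans (im_facts hρ hη0 hb0))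
  have L2 := lip_aux (-ρ) (abs_le.2 ⟨hρ'.1.le, hρ'.2.le⟩) η a b (ha.trans hinv)
    (hη1.le.trans (im_facts hρ' hη0 ha0)) (hη1.le.trans (im_facts hρ' hη0 hb0))
  push_cast at L2
  simp only [← sub_eq_add_neg] at L2
  have a0 : a ≠ 0 := by rintro rfl; simp at ha0
  have b0 : b ≠ 0 := by rintro rfl; simp at hb0
  have ea : η + a ≠ 0 := by
    intro h; have := congrArg Complex.im h; simp at this; linarith
  have eb : η + b ≠ 0 := by
    intro h; have := congrArg Complex.im h; simp at this; linarith
  have key : a - b = a * b * (-(b - a) +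
      ((x : ℂ) ^ 2 * ((η + b) / (η + (1 + ρ) * b) ^ 2 - (η + a) / (η + (1 + ρ) * a) ^ 2) +
      (y : ℂ) ^ 2 * ((η + b) / (η + (1 - ρ) * b) ^ 2 - (η + a) / (η + (1 - ρ) * a) ^ 2))) := by
    have h3 : 1 = a * ((η + a) * ((x : ℂ) ^ 2 / (η + (1 + ρ) * a) ^ 2 + (y : ℂ) ^ 2 / (η + (1 - ρ) * a) ^ 2 - 1)) := by
      rw [← h1]; field_simp; ring
    have h4 : 1 = b * ((η + b) * ((x : ℂ) ^ 2 / (η + (1 + ρ) * b) ^ 2 + (y : ℂ) ^ 2 / (η + (1 - ρ) * b) ^ 2 - 1)) := by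
      rw [← h2]; field_simp; ring
    linear_combination (a) * h4 - b * h3
  have hn : ‖a - b‖ ≤ η.im⁻¹ * η.im⁻¹ * ((1 + 7 * (x ^ 2 + y ^ 2)) * ‖a - b‖) := by
    conv_lhs => rw [key]
    rw [norm_mul, norm_mul]
    gcongr
    refine (norm_add_le _ _).trans ?_
    have : ‖(x : ℂ) ^ 2 * ((η + b) / (η + (1 + ρ) * b) ^ 2 - (η + a) / (η + (1 + ρ) * a) ^ 2) +
      (y : ℂ) ^ 2 * ((η + b) / (η + (1 - ρ) * b) ^ 2 - (η + a) / (η + (1 - ρ) * a) ^ 2)‖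
       ≤ x ^ 2 * (7 * ‖a - b‖) + y ^ 2 * (7 * ‖a - b‖) := by
      refine (norm_add_le _ _).trans ?_
      rw [norm_mul, norm_mul]
      have ex : ‖(x : ℂ) ^ 2‖ = x ^ 2 := by simp
      have ey : ‖(y : ℂ) ^ 2‖ = y ^ 2 := by simp
      rw [ex, ey]
      gcongr
    rw [norm_neg, norm_sub_rev b a]
    linarith
  by_contra hne
  have hpos : 0 < ‖a - b‖ := norm_pos_iff.2 (sub_ne_zero.2 hne)
  have : η.im⁻¹ * η.im⁻¹ * ((1 + 7 * (x ^ 2 + y ^ 2)) * ‖a - b‖) < ‖a - b‖ := by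
    have : η.im⁻¹ * η.im⁻¹ * (1 + 7 * (x ^ 2 + y ^ 2)) < 1 := by
      calc _ < η.im⁻¹ * η.im⁻¹ * η.im := by gcongr
        _ = η.im⁻¹ := by field_simp
        _ ≤ 1 := hinv
    nlinarith
  linarith

lemma sc_unique (ρ : ℝ) (hρ : ρ ∈ Set.Ioo (-1 : ℝ) 1) (z : ℂ) (μ ν : Measure ℝ)
    [IsProbabilityMeasure μ] [IsProbabilityMeasure ν] (hμ : SelfConsistent ρ z μ)
    (hν : SelfConsistent ρ z ν) : μ = ν := by
  apply stieltjes_inj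
  refine uhp_eqOn (stieltjes_diff μ) (stieltjes_diff ν) (1 + 7 * (z.re ^ 2 + z.im ^ 2)) ?_
  intro η hη h0
  exact eq_of_sc ρ hρ z.re z.im η _ _ hη (stieltjes_im_pos μ h0) (stieltjes_im_pos ν h0)
    (stieltjes_norm_le μ h0) (stieltjes_norm_le ν h0) (hμ η h0) (hν η h0)

open Matrix in
def FF {ι : Type} [Fintype ι] [DecidableEq ι] (lam : ι → ℝ) (P : Matrix ι (Fin 2) ℂ) (η : ℂ) :
    Matrix (Fin 2) (Fin 2) ℂ :=
  Pᴴ * Matrix.diagonal (fun i => ((lam i : ℂ) - η)⁻¹) * P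

def Sg (ρ : ℝ) (F : Matrix (Fin 2) (Fin 2) ℂ) : Matrix (Fin 2) (Fin 2) ℂ :=
  !![F 1 1, ρ * F 1 0; ρ * F 0 1, F 0 0]

def ZZ (z : ℂ) : Matrix (Fin 2) (Fin 2) ℂ := !![0, z; star z, 0]

def s1 : Matrix (Fin 2) (Fin 2) ℂ := !![0, 1; 1, 0]

def s2 : Matrix (Fin 2) (Fin 2) ℂ := !![0, -Complex.I; Complex.I, 0]

lemma kraus (ρ : ℝ) (F : Matrix (Fin 2) (Fin 2) ℂ) :
    (((1 + ρ) / 2 : ℝ) : ℂ) • (s1 * F * s1) + (((1 - ρ) / 2 : ℝ) : ℂ) • (s2 * F * s2) = Sg ρ F := by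
  have hI := Complex.I_mul_I
  ext i j
  fin_cases i <;> fin_cases j <;>
    simp only [Matrix.add_apply, Matrix.smul_apply, Matrix.mul_apply, Fin.sum_univ_two] <;>
    simp [s1, s2, Sg]
  · linear_combination (-((1 - ρ) / 2 * F 1 1) : ℂ) * hI
  · linear_combination (((1 - ρ) / 2 * F 1 0) : ℂ) * hI
  · linear_combination (((1 - ρ) / 2 * F 0 1) : ℂ) * hI
  · linear_combination (-((1 - ρ) / 2 * F 0 0) : ℂ) * hI

lemma s1_herm : s1.conjTranspose = s1 := by
  ext i j; fin_cases i <;> fin_cases j <;> simp [s1]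

lemma s2_herm : s2.conjTranspose = s2 := by
  ext i j; fin_cases i <;> fin_cases j <;> simp [s2]

lemma ZZ_herm (z : ℂ) : (ZZ z).conjTranspose = ZZ z := by
  ext i j; fin_cases i <;> fin_cases j <;> simp [ZZ]

open Matrix in
lemma step {ι : Type} [Fintype ι] [DecidableEq ι] (ρ : ℝ) (hρ : ρ ∈ Set.Ioo (-1 : ℝ) 1) (z : ℂ)
    (lam : ι → ℝ) (P : Matrix ι (Fin 2) ℂ) (hP : Pᴴ * P = 1) :
    ∃ (lam' : (Fin 2 ⊕ (ι ⊕ ι)) → ℝ) (P' : Matrix (Fin 2 ⊕ (ι ⊕ ι)) (Fin 2) ℂ), P'ᴴ * P' = 1 ∧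
      (P'ᴴ * Matrix.diagonal (fun i => (lam' i : ℂ) ^ 2) * P') 0 0 = ((‖z‖ ^ 2 + 1 : ℝ) : ℂ) ∧
      ∀ η : ℂ, 0 < η.im → (-ZZ z - η • 1 - Sg ρ (FF lam P η)) * FF lam' P' η = 1 := by
  set c1 : ℝ := Real.sqrt ((1 + ρ) / 2)
  set c2 : ℝ := Real.sqrt ((1 - ρ) / 2)
  have hc1 : ((c1 : ℂ)) * c1 = (((1 + ρ) / 2 : ℝ) : ℂ) := by
    rw [← Complex.ofReal_mul, Real.mul_self_sqrt (by linarith [hρ.1])]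
  have hc2 : ((c2 : ℂ)) * c2 = (((1 - ρ) / 2 : ℝ) : ℂ) := by
    rw [← Complex.ofReal_mul, Real.mul_self_sqrt (by linarith [hρ.2])]
  set B : Matrix (ι ⊕ ι) (Fin 2) ℂ := fromRows ((c1 : ℂ) • (P * s1)) ((c2 : ℂ) • (P * s2)) with hB
  have hBK : ∀ d : ι → ℂ, Bᴴ * Matrix.diagonal (Sum.elim d d) * B = Sg ρ (Pᴴ * Matrix.diagonal d * P) := by
    intro d
    rw [← kraus, ← hc1, ← hc2, hB, conjTranspose_fromRows_eq_fromCols_conjTranspose,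
      ← fromBlocks_diagonal, fromCols_mul_fromBlocks, fromCols_mul_fromRows]
    simp [conjTranspose_mul, s1_herm, s2_herm, smul_smul, Matrix.mul_assoc]
    rw [← Complex.ofReal_mul, ← Complex.ofReal_mul, Complex.coe_smul, Complex.coe_smul]
  set D : Matrix (ι ⊕ ι) (ι ⊕ ι) ℂ := Matrix.diagonal (Sum.elim (fun i => (lam i : ℂ)) (fun i => (lam i : ℂ)))
    with hD
  set A := fromBlocks (-ZZ z) Bᴴ B D with hA
  have hAh : A.IsHermitian := by
    rw [hA, isHermitian_fromBlocks_iff]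
    refine ⟨?_, by simp, by simp, ?_⟩
    · simp [Matrix.IsHermitian, ZZ_herm]
    · rw [hD]
      apply Matrix.isHermitian_diagonal_of_self_adjoint
      ext i
      rcases i with i | i <;> simp
  set U : Matrix (Fin 2 ⊕ (ι ⊕ ι)) (Fin 2 ⊕ (ι ⊕ ι)) ℂ := hAh.eigenvectorUnitary.1 with hU
  set l := hAh.eigenvalues with hl
  have hUU : Uᴴ * U = 1 := Unitary.coe_star_mul_self hAh.eigenvectorUnitary
  have hUU' : U * Uᴴ = 1 := Unitary.coe_mul_star_self hAh.eigenvectorUnitary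
  have hspec : A = U * Matrix.diagonal (fun i => (l i : ℂ)) * Uᴴ := by
    have := hAh.spectral_theorem
    rw [Unitary.conjStarAlgAut_apply] at this
    exact this
  clear_value U l
  set Q : Matrix (Fin 2 ⊕ (ι ⊕ ι)) (Fin 2) ℂ := fromRows 1 0 with hQ
  have hQQ : Qᴴ * Q = 1 := by
    rw [hQ, conjTranspose_fromRows_eq_fromCols_conjTranspose, fromCols_mul_fromRows]
    simp
  refine ⟨l, Uᴴ * Q, ?_, ?_, ?_⟩
  · rw [conjTranspose_mul, conjTranspose_conjTranspose, Matrix.mul_assoc, ← Matrix.mul_assoc U,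
      hUU', Matrix.one_mul, hQQ]
  · have e1 : (Uᴴ * Q)ᴴ * Matrix.diagonal (fun i => (l i : ℂ) ^ 2) * (Uᴴ * Q) = Qᴴ * (A * A) * Q := by
      have : A * A = U * Matrix.diagonal (fun i => (l i : ℂ) ^ 2) * Uᴴ := by
        rw [hspec]
        calc _ = U * Matrix.diagonal (fun i => (l i : ℂ)) * (Uᴴ * U) * Matrix.diagonal (fun i => (l i : ℂ)) * Uᴴ := by
              simp only [Matrix.mul_assoc]
          _ = _ := by
            rw [hUU, Matrix.mul_one, Matrix.mul_assoc U, Matrix.diagonal_mul_diagonal]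
            simp only [sq]
      rw [this, conjTranspose_mul, conjTranspose_conjTranspose]
      simp only [Matrix.mul_assoc]
    rw [e1, hA, fromBlocks_multiply, hQ, conjTranspose_fromRows_eq_fromCols_conjTranspose,
      fromCols_mul_fromBlocks, fromCols_mul_fromRows]
    have := hBK (fun _ => 1)
    simp only [Sum.elim_lam_const_lam_const, diagonal_one, Matrix.mul_one, hP] at this
    simp [this]
    simp [ZZ, Sg, Complex.mul_conj, Complex.normSq_eq_norm_sq]
  · intro η hη
    set R : Matrix (Fin 2 ⊕ (ι ⊕ ι)) (Fin 2 ⊕ (ι ⊕ ι)) ℂ := Matrix.diagonal (fun i => ((l i : ℂ) - η)⁻¹) with hR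
    set X := U * R * Uᴴ * Q with hX
    have hF : FF l (Uᴴ * Q) η = Qᴴ * X := by
      rw [FF, conjTranspose_mul, conjTranspose_conjTranspose, hX]
      simp only [Matrix.mul_assoc]
      rfl
    have hAX : (A - η • 1) * X = Q := by
      have e1 : A - η • 1 = U * (Matrix.diagonal (fun i => (l i : ℂ) - η)) * Uᴴ := by
        have : Matrix.diagonal (fun i => (l i : ℂ) - η) = Matrix.diagonal (fun i => (l i : ℂ)) - η • 1 := by
          rw [smul_one_eq_diagonal, diagonal_sub]
        rw [this, Matrix.mul_sub, Matrix.sub_mul, ← hspec]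
        simp [hUU']
      have e2 : Matrix.diagonal (fun i => (l i : ℂ) - η) * R = 1 := by
        rw [hR, diagonal_mul_diagonal, ← diagonal_one]
        congr 1
        ext i
        exact mul_inv_cancel₀ (sub_ne_zero_of_im hη _)
      rw [e1, hX]
      calc _ = U * (Matrix.diagonal (fun i => (l i : ℂ) - η) * ((Uᴴ * U) * R)) * Uᴴ * Q := by
            simp only [Matrix.mul_assoc]
        _ = Q := by rw [hUU, Matrix.one_mul, e2, Matrix.mul_one, hUU', Matrix.one_mul]
    obtain ⟨X1, X2, hX12⟩ : ∃ X1 X2, X = fromRows X1 X2 := ⟨X.toRows₁, X.toRows₂, by simp⟩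
    have hF' : FF l (Uᴴ * Q) η = X1 := by
      rw [hF, hX12, hQ, conjTranspose_fromRows_eq_fromCols_conjTranspose, fromCols_mul_fromRows]
      simp
    have hblk : A - η • 1 = fromBlocks (-ZZ z - η • 1) Bᴴ B (D - η • 1) := by
      rw [hA, ← fromBlocks_one, fromBlocks_smul, sub_eq_add_neg, fromBlocks_neg, fromBlocks_add]
      simp [sub_eq_add_neg]
    rw [hblk, hX12, hQ, fromBlocks_mul_fromRows] at hAX
    obtain ⟨g1, g2⟩ := fromRows_inj hAX
    set R2 : Matrix (ι ⊕ ι) (ι ⊕ ι) ℂ := Matrix.diagonal (Sum.elim (fun i => ((lam i : ℂ) - η)⁻¹) (fun i => ((lam i : ℂ) - η)⁻¹)) with hR2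
    have hRD : R2 * (D - η • 1) = 1 := by
      rw [hR2, hD, smul_one_eq_diagonal, diagonal_sub, diagonal_mul_diagonal, ← diagonal_one]
      congr 1
      ext i
      rcases i with i | i <;> exact inv_mul_cancel₀ (sub_ne_zero_of_im hη _)
    have hX2 : X2 = - (R2 * (B * X1)) := by
      have : R2 * (B * X1 + (D - η • 1) * X2) = 0 := by rw [g2, Matrix.mul_zero]
      rw [Matrix.mul_add, ← Matrix.mul_assoc R2 (D - η • 1), hRD, Matrix.one_mul] at this
      exact eq_neg_of_add_eq_zero_right this
    rw [hX2, Matrix.mul_neg, ← sub_eq_add_neg] at g1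
    rw [hF', FF, ← hBK, Matrix.sub_mul, ← hR2, Matrix.mul_assoc, Matrix.mul_assoc]
    exact g1

open Matrix in
structure Rlz (z : ℂ) where
  ι : Type
  fι : Fintype ι
  dι : DecidableEq ι
  lam : ι → ℝ
  P : Matrix ι (Fin 2) ℂ
  hP : Pᴴ * P = 1
  hm : ((Pᴴ * Matrix.diagonal (fun i => (lam i : ℂ) ^ 2) * P) 0 0).re ≤ ‖z‖ ^ 2 + 1
  hd : ∀ η : ℂ, 0 < η.im → FF lam P η 0 0 = FF lam P η 1 1

attribute [instance] Rlz.fι Rlz.dι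

def Rlz.F {z : ℂ} (R : Rlz z) (η : ℂ) : Matrix (Fin 2) (Fin 2) ℂ := FF R.lam R.P η

def Rlz.base (z : ℂ) : Rlz z where
  ι := Fin 2
  fι := inferInstance
  dι := inferInstance
  lam := 0
  P := 1
  hP := by simp
  hm := by simp; positivity
  hd := by intro η _; simp [FF]

lemma NN_eqs {ρ : ℝ} {z η : ℂ} {F G : Matrix (Fin 2) (Fin 2) ℂ}
    (h : (-ZZ z - η • 1 - Sg ρ F) * G = 1) :
    (-(η + F 1 1)) * G 0 0 + (-(z + ρ * F 1 0)) * G 1 0 = 1 ∧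
    (-(η + F 1 1)) * G 0 1 + (-(z + ρ * F 1 0)) * G 1 1 = 0 ∧
    (-(star z + ρ * F 0 1)) * G 0 0 + (-(η + F 0 0)) * G 1 0 = 0 ∧
    (-(star z + ρ * F 0 1)) * G 0 1 + (-(η + F 0 0)) * G 1 1 = 1 := by
  have h00 := congrFun (congrFun h 0) 0
  have h01 := congrFun (congrFun h 0) 1
  have h10 := congrFun (congrFun h 1) 0
  have h11 := congrFun (congrFun h 1) 1
  rw [Matrix.mul_apply, Fin.sum_univ_two] at h00 h01 h10 h11
  simp [ZZ, Sg] at h00 h01 h10 h11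
  refine ⟨?_, ?_, ?_, ?_⟩
  · linear_combination h00
  · linear_combination h01
  · simp; linear_combination h10
  · simp; linear_combination h11

lemma diag_eq {ρ : ℝ} {z η : ℂ} {F G : Matrix (Fin 2) (Fin 2) ℂ}
    (h : (-ZZ z - η • 1 - Sg ρ F) * G = 1) (hF : F 0 0 = F 1 1) : G 0 0 = G 1 1 := by
  obtain ⟨h1, h2, h3, h4⟩ := NN_eqs h
  rw [hF] at h3 h4
  generalize -(η + F 1 1) = α at *
  generalize -(z + ρ * F 1 0) = β at *
  generalize -(star z + ρ * F 0 1) = γ at *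
  have e : (α * α - β * γ) * (G 0 0 * G 1 1 - G 0 1 * G 1 0) = 1 := by
    linear_combination h4 * (α * G 0 0 + β * G 1 0) + h1 - (γ * G 0 0 + α * G 1 0) * h2
  have e0 : α * α - β * γ ≠ 0 := left_ne_zero_of_mul_eq_one e
  have k1 : (α * α - β * γ) * G 0 0 = α := by linear_combination α * h1 - β * h3
  have k2 : (α * α - β * γ) * G 1 1 = α := by linear_combination α * h4 - γ * h2
  exact mul_left_cancel₀ e0 (k1.trans k2.symm)

lemma Rlz.next (ρ : ℝ) (hρ : ρ ∈ Set.Ioo (-1 : ℝ) 1) (z : ℂ) (R : Rlz z) :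
    ∃ R' : Rlz z, ∀ η : ℂ, 0 < η.im → (-ZZ z - η • 1 - Sg ρ (R.F η)) * R'.F η = 1 := by
  obtain ⟨l, P, h1, h2, h3⟩ := step ρ hρ z R.lam R.P R.hP
  refine ⟨⟨_, inferInstance, inferInstance, l, P, h1, ?_, ?_⟩, h3⟩
  · exact le_of_eq ((congrArg Complex.re h2).trans (Complex.ofReal_re _))
  · intro η hη
    exact diag_eq (h3 η hη) (R.hd η hη)

lemma FF_apply {ι : Type} [Fintype ι] [DecidableEq ι] (lam : ι → ℝ) (P : Matrix ι (Fin 2) ℂ)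
    (η : ℂ) (i j : Fin 2) :
    FF lam P η i j = ∑ k, star (P k i) * ((lam k : ℂ) - η)⁻¹ * P k j := by
  rw [FF, Matrix.mul_apply]
  refine Finset.sum_congr rfl fun k _ => ?_
  rw [Matrix.mul_diagonal, Matrix.conjTranspose_apply]

lemma Rlz.sum_one {z : ℂ} (R : Rlz z) (i : Fin 2) : ∑ k, ‖R.P k i‖ ^ 2 = 1 := by
  have := congrFun (congrFun R.hP i) i
  rw [Matrix.mul_apply, Matrix.one_apply_eq] at this
  have e : ((∑ k, ‖R.P k i‖ ^ 2 : ℝ) : ℂ) = 1 := by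
    rw [← this]
    push_cast
    refine Finset.sum_congr rfl fun k _ => ?_
    rw [Matrix.conjTranspose_apply, mul_comm]
    exact (Complex.mul_conj' _).symm
  exact_mod_cast e

lemma Rlz.bound {z : ℂ} (R : Rlz z) {η : ℂ} (hη : 0 < η.im) (i j : Fin 2) :
    ‖R.F η i j‖ ≤ η.im⁻¹ := by
  rw [Rlz.F, FF_apply]
  calc _ ≤ ∑ k, ‖star (R.P k i) * ((R.lam k : ℂ) - η)⁻¹ * R.P k j‖ := norm_sum_le _ _
    _ ≤ ∑ k, η.im⁻¹ * ((‖R.P k i‖ ^ 2 + ‖R.P k j‖ ^ 2) / 2) := by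
      refine Finset.sum_le_sum fun k _ => ?_
      rw [norm_mul, norm_mul, norm_star]
      have := norm_inv_le hη (R.lam k)
      calc _ = ‖((R.lam k : ℂ) - η)⁻¹‖ * (‖R.P k i‖ * ‖R.P k j‖) := by ring
        _ ≤ _ := by
          gcongr
          nlinarith [sq_nonneg (‖R.P k i‖ - ‖R.P k j‖)]
    _ = η.im⁻¹ := by
      rw [← Finset.mul_sum, ← Finset.sum_div, Finset.sum_add_distrib, R.sum_one, R.sum_one]
      norm_num

lemma diff_eq {ρ : ℝ} {z η : ℂ} {F F' G G' : Matrix (Fin 2) (Fin 2) ℂ}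
    (h : (-ZZ z - η • 1 - Sg ρ F) * G = 1) (h' : (-ZZ z - η • 1 - Sg ρ F') * G' = 1) :
    G' - G = G' * (Sg ρ (F' - F)) * G := by
  have h'' := mul_eq_one_comm.1 h'
  have e : Sg ρ (F' - F) = (-ZZ z - η • 1 - Sg ρ F) - (-ZZ z - η • 1 - Sg ρ F') := by
    have : Sg ρ (F' - F) = Sg ρ F' - Sg ρ F := by
      ext i j
      fin_cases i <;> fin_cases j <;> simp [Sg, mul_sub]
    rw [this]; abel
  rw [e, mul_sub, sub_mul, h'', one_mul, mul_assoc, h, mul_one]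

lemma Sg_bound {ρ : ℝ} (hρ : ρ ∈ Set.Ioo (-1 : ℝ) 1) {F : Matrix (Fin 2) (Fin 2) ℂ} {δ : ℝ}
    (h : ∀ i j, ‖F i j‖ ≤ δ) (i j : Fin 2) : ‖Sg ρ F i j‖ ≤ δ := by
  have hr : |ρ| ≤ 1 := abs_le.2 ⟨hρ.1.le, hρ.2.le⟩
  fin_cases i <;> fin_cases j <;> simp [Sg]
  · exact h _ _
  · exact (mul_le_of_le_one_left (norm_nonneg _) hr).trans (h _ _)
  · exact (mul_le_of_le_one_left (norm_nonneg _) hr).trans (h _ _)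
  · exact h _ _

lemma prod_bound {A B C : Matrix (Fin 2) (Fin 2) ℂ} {δ : ℝ}
    (hA : ∀ i j, ‖A i j‖ ≤ 1 / 4) (hC : ∀ i j, ‖C i j‖ ≤ 1 / 4) (hB : ∀ i j, ‖B i j‖ ≤ δ)
    (i j : Fin 2) : ‖(A * B * C) i j‖ ≤ δ * (1 / 4) := by
  have e : ∀ k l, ‖A i k * B k l * C l j‖ ≤ 1 / 4 * δ * (1 / 4) := by
    intro k l
    rw [norm_mul, norm_mul]
    have := (norm_nonneg _).trans (hB 0 0)
    gcongr
    · exact hA _ _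
    · exact hB _ _
    · exact hC _ _
  have : (A * B * C) i j = A i 0 * B 0 0 * C 0 j + A i 1 * B 1 0 * C 0 j
      + (A i 0 * B 0 1 * C 1 j + A i 1 * B 1 1 * C 1 j) := by
    simp only [Matrix.mul_apply, Fin.sum_univ_two]; ring
  rw [this]
  refine (norm_add_le _ _).trans ?_
  have t1 := norm_add_le (A i 0 * B 0 0 * C 0 j) (A i 1 * B 1 0 * C 0 j)
  have t2 := norm_add_le (A i 0 * B 0 1 * C 1 j) (A i 1 * B 1 1 * C 1 j)
  linarith [e 0 0, e 0 1, e 1 0, e 1 1]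

open Filter Topology in
lemma limit_exists {ρ : ℝ} (hρ : ρ ∈ Set.Ioo (-1 : ℝ) 1) {z : ℂ} (S : ℕ → Rlz z)
    (hS : ∀ k, ∀ η : ℂ, 0 < η.im → (-ZZ z - η • 1 - Sg ρ ((S k).F η)) * (S (k + 1)).F η = 1)
    {η : ℂ} (hη : 4 < η.im) :
    ∃ a b c : ℂ, Tendsto (fun k => (S k).F η 0 0) atTop (𝓝 a) ∧
      (-(η + a)) * a + (-(z + ρ * c)) * c = 1 ∧
      (-(η + a)) * b + (-(z + ρ * c)) * a = 0 ∧
      (-(star z + ρ * b)) * a + (-(η + a)) * c = 0 := by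
  have h0 : 0 < η.im := by linarith
  have hb : ∀ k i j, ‖(S k).F η i j‖ ≤ 1 / 4 := fun k i j => ((S k).bound h0 i j).trans <| by
    rw [one_div]; exact inv_anti₀ (by norm_num) hη.le
  have hd : ∀ k i j, ‖((S (k + 1)).F η - (S k).F η) i j‖ ≤ 1 / 2 * (1 / 4) ^ k := by
    intro k
    induction k with
    | zero =>
      intro i j
      rw [Matrix.sub_apply]
      refine (norm_sub_le _ _).trans ?_
      linarith [hb (0 + 1) i j, hb 0 i j]
    | succ k ih =>
      intro i j
      rw [diff_eq (hS k η h0) (hS (k + 1) η h0), pow_succ, ← mul_assoc]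
      exact prod_bound (hb _) (hb _) (Sg_bound hρ ih) i j
  have hlim : ∀ i j, ∃ L, Tendsto (fun k => (S k).F η i j) atTop (𝓝 L) := by
    intro i j
    apply cauchySeq_tendsto_of_complete
    refine cauchySeq_of_le_geometric (1 / 4) (1 / 2) (by norm_num) fun k => ?_
    rw [dist_comm, dist_eq_norm]
    exact hd k i j
  obtain ⟨a, ha⟩ := hlim 0 0
  obtain ⟨b, hb'⟩ := hlim 0 1
  obtain ⟨c, hc⟩ := hlim 1 0
  have ha' : Tendsto (fun k => (S k).F η 1 1) atTop (𝓝 a) := ha.congr fun k => (S k).hd η h0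
  have sh : ∀ {f : ℕ → ℂ} {L : ℂ}, Tendsto f atTop (𝓝 L) → Tendsto (fun k => f (k + 1)) atTop (𝓝 L) :=
    fun h => h.comp (tendsto_add_atTop_nat 1)
  refine ⟨a, b, c, ha, ?_, ?_, ?_⟩
  · refine tendsto_nhds_unique (f := fun _ : ℕ => (1 : ℂ)) (l := atTop) ?_ tendsto_const_nhds
    exact ((((ha'.const_add η).neg).mul (sh ha)).add
      ((((hc.const_mul (ρ : ℂ)).const_add z).neg).mul (sh hc))).congr fun k => (NN_eqs (hS k η h0)).1
  · refine tendsto_nhds_unique (f := fun _ : ℕ => (0 : ℂ)) (l := atTop) ?_ tendsto_const_nhds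
    exact ((((ha'.const_add η).neg).mul (sh hb')).add
      ((((hc.const_mul (ρ : ℂ)).const_add z).neg).mul (sh ha'))).congr fun k => (NN_eqs (hS k η h0)).2.1
  · refine tendsto_nhds_unique (f := fun _ : ℕ => (0 : ℂ)) (l := atTop) ?_ tendsto_const_nhds
    exact (((((hb'.const_mul (ρ : ℂ)).const_add (star z)).neg).mul (sh ha)).add
      (((ha.const_add η).neg).mul (sh hc))).congr fun k => (NN_eqs (hS k η h0)).2.2.1

def Rlz.meas {z : ℂ} (R : Rlz z) : Measure ℝ :=
  ∑ i, ENNReal.ofReal (‖R.P i 0‖ ^ 2) • Measure.dirac (R.lam i)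

instance {z : ℂ} (R : Rlz z) : IsProbabilityMeasure R.meas := by
  constructor
  simp only [Rlz.meas, Measure.coe_finset_sum, Finset.sum_apply, Measure.smul_apply, measure_univ,
    smul_eq_mul, mul_one]
  rw [← ENNReal.ofReal_sum_of_nonneg (fun _ _ => by positivity), R.sum_one]
  simp

lemma Rlz.stieltjes_meas {z : ℂ} (R : Rlz z) {η : ℂ} (hη : 0 < η.im) :
    stieltjes R.meas η = R.F η 0 0 := by
  rw [stieltjes, Rlz.meas, integral_finset_sum_measure, Rlz.F, FF_apply]
  · refine Finset.sum_congr rfl fun i _ => ?_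
    rw [integral_smul_measure, integral_dirac, ENNReal.toReal_ofReal (by positivity)]
    have : star (R.P i 0) * R.P i 0 = ((‖R.P i 0‖ ^ 2 : ℝ) : ℂ) := by
      rw [mul_comm]; push_cast; exact Complex.mul_conj' _
    rw [Complex.real_smul, ← this]
    ring
  · intro i _
    exact (integrable_res _ hη).smul_measure ENNReal.ofReal_ne_top

lemma Rlz.second_moment {z : ℂ} (R : Rlz z) :
    (∫⁻ u : ℝ, ENNReal.ofReal (u ^ 2) ∂(R.meas)) ≤ ENNReal.ofReal (‖z‖ ^ 2 + 1) := by
  rw [Rlz.meas, lintegral_finset_sum_measure]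
  simp only [lintegral_smul_measure, lintegral_dirac, smul_eq_mul]
  simp_rw [← ENNReal.ofReal_mul (sq_nonneg _)]
  rw [← ENNReal.ofReal_sum_of_nonneg (fun _ _ => by positivity)]
  apply ENNReal.ofReal_le_ofReal
  refine le_trans (le_of_eq ?_) R.hm
  rw [Matrix.mul_apply, Complex.re_sum]
  refine Finset.sum_congr rfl fun i _ => ?_
  have : star (R.P i 0) * R.P i 0 = ((‖R.P i 0‖ ^ 2 : ℝ) : ℂ) := by
    rw [mul_comm]; push_cast; exact Complex.mul_conj' _
  rw [Matrix.mul_diagonal, Matrix.conjTranspose_apply, mul_right_comm, this, ← Complex.ofReal_pow, ← Complex.ofReal_mul,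
    Complex.ofReal_re]

lemma tight (z : ℂ) (S : ℕ → Rlz z) : IsTightMeasureSet (Set.range fun k => (S k).meas) := by
  rw [isTightMeasureSet_iff_exists_isCompact_measure_compl_le]
  intro ε hε
  set C := ENNReal.ofReal (‖z‖ ^ 2 + 1) with hC
  have hCt : C ≠ ⊤ := ENNReal.ofReal_ne_top
  obtain ⟨n, hn⟩ := ENNReal.exists_nat_mul_gt hε.ne' hCt
  refine ⟨Metric.closedBall 0 (n + 1), isCompact_closedBall _ _, ?_⟩
  rintro _ ⟨k, rfl⟩
  have hsub : (Metric.closedBall (0 : ℝ) (n + 1))ᶜ ⊆ {u : ℝ | (n : ENNReal) + 1 ≤ ENNReal.ofReal (u ^ 2)} := by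
    intro u hu
    simp only [Set.mem_compl_iff, mem_closedBall_zero_iff, Real.norm_eq_abs, not_le] at hu
    have : (n : ENNReal) + 1 = ENNReal.ofReal (n + 1) := by
      rw [ENNReal.ofReal_add (by positivity) (by positivity)]; simp
    rw [Set.mem_setOf_eq, this]
    apply ENNReal.ofReal_le_ofReal
    rw [← sq_abs]
    have h0 : (0 : ℝ) ≤ n := by positivity
    nlinarith
  refine (measure_mono hsub).trans ?_
  have hM := mul_meas_ge_le_lintegral (μ := (S k).meas) (f := fun u : ℝ => ENNReal.ofReal (u ^ 2))
    (by fun_prop) ((n : ENNReal) + 1)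
  have h1 := hM.trans (S k).second_moment
  have h2 : ((n : ENNReal) + 1) * (S k).meas {u : ℝ | (n : ENNReal) + 1 ≤ ENNReal.ofReal (u ^ 2)} ≤ ((n : ENNReal) + 1) * ε := by
    refine h1.trans (hn.le.trans ?_)
    gcongr
    simp
  rwa [ENNReal.mul_le_mul_iff_right (by simp) (by simp)] at h2

def resBCF {η : ℂ} (h : 0 < η.im) : BoundedContinuousFunction ℝ ℂ :=
  BoundedContinuousFunction.ofNormedAddCommGroup (fun u : ℝ => ((u : ℂ) - η)⁻¹) (cont_res h) η.im⁻¹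
    (norm_inv_le h)

lemma sc_alg {ρ : ℝ} (hρ : ρ ∈ Set.Ioo (-1 : ℝ) 1) {z η a b c : ℂ} (hη : 0 < η.im) (ha : 0 < a.im)
    (h1 : (-(η + a)) * a + (-(z + ρ * c)) * c = 1)
    (h2 : (-(η + a)) * b + (-(z + ρ * c)) * a = 0)
    (h3 : (-(star z + ρ * b)) * a + (-(η + a)) * c = 0) :
    1 / (a * (η + a)) + 1 =
      (z.re : ℂ) ^ 2 / (η + (1 + ρ) * a) ^ 2 + (z.im : ℂ) ^ 2 / (η + (1 - ρ) * a) ^ 2 := by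
  have hρ' : -ρ ∈ Set.Ioo (-1 : ℝ) 1 := ⟨by linarith [hρ.2], by linarith [hρ.1]⟩
  have a0 : a ≠ 0 := by rintro rfl; simp at ha
  have ea : η + a ≠ 0 := by
    intro h; have := congrArg Complex.im h; simp at this; linarith
  have p0 : η + (1 + ρ) * a ≠ 0 := by
    rw [← norm_pos_iff]; exact hη.trans_le (im_facts hρ hη ha)
  have q0 : η + (1 - ρ) * a ≠ 0 := by
    have := hη.trans_le (im_facts hρ' hη ha)
    rw [norm_pos_iff] at this
    simpa [sub_eq_add_neg] using this
  have hz : z = z.re + z.im * Complex.I := (Complex.re_add_im z).symm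
  have hz' : star z = z.re - z.im * Complex.I := by
    apply Complex.ext <;> simp
  have hI := Complex.I_mul_I
  generalize (z.re : ℂ) = x at *
  generalize (z.im : ℂ) = y at *
  rw [hz'] at h3
  rw [hz] at h1 h2
  have k1 : (b + c) = - 2 * x * a / (η + (1 + ρ) * a) := by
    rw [eq_div_iff p0]; linear_combination - h2 - h3
  have k2 : (b - c) = - 2 * y * Complex.I * a / (η + (1 - ρ) * a) := by
    rw [eq_div_iff q0]; linear_combination - h2 + h3
  have k3 : b * c = a ^ 2 * (x ^ 2 / (η + (1 + ρ) * a) ^ 2 + y ^ 2 / (η + (1 - ρ) * a) ^ 2) := by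
    have : b * c = ((b + c) ^ 2 - (b - c) ^ 2) / 4 := by ring
    rw [this, k1, k2]
    have hI2 : Complex.I ^ 2 = -1 := Complex.I_sq
    simp only [div_pow, mul_pow, hI2]
    ring
  have k4 : (η + a) * (a ^ 2 - b * c) = - a := by
    linear_combination - a * h1 + c * h2
  have k5 : x ^ 2 / (η + (1 + ρ) * a) ^ 2 + y ^ 2 / (η + (1 - ρ) * a) ^ 2 = b * c / a ^ 2 := by
    rw [k3]; field_simp
  rw [k5]
  field_simp
  linear_combination k4

open Filter Topology in
lemma sc_exists (ρ : ℝ) (hρ : ρ ∈ Set.Ioo (-1 : ℝ) 1) (z : ℂ) :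
    ∃ ν : Measure ℝ, IsProbabilityMeasure ν ∧ SelfConsistent ρ z ν := by
  choose nx hnx using Rlz.next ρ hρ z
  let S : ℕ → Rlz z := fun k => nx^[k] (Rlz.base z)
  have hS : ∀ k, ∀ η : ℂ, 0 < η.im →
      (-ZZ z - η • 1 - Sg ρ ((S k).F η)) * (S (k + 1)).F η = 1 := by
    intro k η hη
    simp only [S, Function.iterate_succ_apply']
    exact hnx _ η hη
  let M : ℕ → ProbabilityMeasure ℝ := fun k => ⟨(S k).meas, inferInstance⟩
  have hcomp : IsCompact (closure (Set.range M)) := by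
    apply isCompact_closure_of_isTightMeasureSet
    convert tight z S
    ext μ
    constructor
    · rintro ⟨_, ⟨k, rfl⟩, rfl⟩
      exact ⟨k, rfl⟩
    · rintro ⟨k, rfl⟩
      exact ⟨_, ⟨k, rfl⟩, rfl⟩
  obtain ⟨ν, -, hν⟩ := hcomp.ultrafilter_le_nhds ((hyperfilter ℕ).map M) (by
    rw [le_principal_iff]
    exact Filter.mem_of_superset (Filter.range_mem_map) subset_closure)
  have hν' : Tendsto M (hyperfilter ℕ) (𝓝 ν) := hν
  rw [ProbabilityMeasure.tendsto_iff_forall_integral_rclike_tendsto ℂ] at hν'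
  refine ⟨ν, inferInstance, ?_⟩
  have hpos : ∀ η : ℂ, 0 < η.im → 0 < (stieltjes ν η).im := fun η h => stieltjes_im_pos _ h
  have hρ' : -ρ ∈ Set.Ioo (-1 : ℝ) 1 := ⟨by linarith [hρ.2], by linarith [hρ.1]⟩
  have hs := stieltjes_diff (ν : Measure ℝ)
  have a0 : ∀ η ∈ {η : ℂ | 0 < η.im}, stieltjes ν η * (η + stieltjes ν η) ≠ 0 := by
    intro η hη
    have ha := hpos η hη
    apply mul_ne_zero
    · intro h; rw [h] at ha; simp at ha
    · intro h; have := congrArg Complex.im h; simp at this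
      have : 0 < η.im := hη
      linarith
  have p0 : ∀ η ∈ {η : ℂ | 0 < η.im}, (η + (1 + ρ) * stieltjes ν η) ^ 2 ≠ 0 := by
    intro η hη
    apply pow_ne_zero
    rw [← norm_pos_iff]; exact lt_of_lt_of_le hη (im_facts hρ hη (hpos η hη))
  have q0 : ∀ η ∈ {η : ℂ | 0 < η.im}, (η + (1 - ρ) * stieltjes ν η) ^ 2 ≠ 0 := by
    intro η hη
    apply pow_ne_zero
    have := lt_of_lt_of_le hη (im_facts hρ' hη (hpos η hη))
    rw [norm_pos_iff] at this
    simpa [sub_eq_add_neg] using this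
  have hid : DifferentiableOn ℂ (fun η : ℂ => η) {η : ℂ | 0 < η.im} := differentiableOn_id
  refine uhp_eqOn (f := fun η => 1 / (stieltjes ν η * (η + stieltjes ν η)) + 1)
    (g := fun η => (z.re : ℂ) ^ 2 / (η + (1 + ρ) * stieltjes ν η) ^ 2 +
        (z.im : ℂ) ^ 2 / (η + (1 - ρ) * stieltjes ν η) ^ 2) ?_ ?_ 4 ?_
  · exact ((differentiableOn_const 1).div (hs.mul (hid.add hs)) a0).add_const _
  · exact ((differentiableOn_const _).div ((hid.add (hs.const_mul _)).pow 2) p0).add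
      ((differentiableOn_const _).div ((hid.add (hs.const_mul _)).pow 2) q0)
  · intro η hη h0
    obtain ⟨a, b, c, hl, h1, h2, h3⟩ := limit_exists hρ S hS hη
    have hl2 : Tendsto (fun k => (S k).F η 0 0) (hyperfilter ℕ) (𝓝 (stieltjes ν η)) := by
      refine (hν' (resBCF h0)).congr fun k => ?_
      exact (S k).stieltjes_meas h0
    have : stieltjes ν η = a := tendsto_nhds_unique hl2 (hl.mono_left Nat.hyperfilter_le_atTop)
    have hp := hpos η h0
    simp only [this] at hp ⊢
    exact sc_alg hρ h0 hp h1 h2 h3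

theorem stmt18 (ρ : ℝ) (hρ : ρ ∈ Set.Ioo (-1 : ℝ) 1) (z : ℂ) :
    ∃! ν : Measure ℝ, IsProbabilityMeasure ν ∧ SelfConsistent ρ z ν := by
  obtain ⟨ν, h1, h2⟩ := sc_exists ρ hρ z
  refine ⟨ν, ⟨h1, h2⟩, ?_⟩
  rintro μ ⟨h3, h4⟩
  exact sc_unique ρ hρ z μ ν h4 h2

end
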